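/- Let n ≥ 3 be an integer with n ≡ 3 (mod 6), let λ ≥ 1 be a real number, and let p : ZMod n → ℂ satisfy 1 ≤ ‖p j‖ ≤ λ and 1 ≤ ‖p j - p (j-1)‖ ≤ λ for every j ∈ ZMod n. Then λ ≥ 2·sin((π/6)·(n/(n-1))). -/

import Mathlib

open Real

/-- The side opposite to an angle `t` in a triangle with adjacent sides `2 sin X`, `2 sin Y`,
squared, in terms of `cos (X + Y)` and `cos (X - Y)`. -/
lemma four_sin_sq_add_four_sin_sq_sub (X Y c : ℝ) :
    (2 * sin X) ^ 2 + (2 * sin Y) ^ 2 - 2 * (2 * sin X) * (2 * sin Y) * c =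
      4 - 4 * cos (X + Y) * cos (X - Y) - 4 * (cos (X - Y) - cos (X + Y)) * c := by
  rw [cos_add, cos_sub]
  linear_combination 4 * cos X ^ 2 * sin_sq_add_cos_sq Y +
    (4 - 4 * sin Y ^ 2) * sin_sq_add_cos_sq X

/-- Lower bound for the angle between sides of length `2 sin X` and `2 sin Y` whose opposite side
has length at least `1`. -/
lemma two_pi_div_three_le_angle_add {X Y t : ℝ} (hX : π / 6 ≤ X) (hY : π / 6 ≤ Y)
    (ht : 0 ≤ t)
    (h : 1 ≤ (2 * sin X) ^ 2 + (2 * sin Y) ^ 2 - 2 * (2 * sin X) * (2 * sin Y) * cos t) :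
    2 * π / 3 ≤ t + X + Y := by
  by_contra! hlt
  have hπ := pi_pos
  have hsX : 0 < sin X := sin_pos_of_pos_of_lt_pi (by linarith) (by linarith)
  have hsY : 0 < sin Y := sin_pos_of_pos_of_lt_pi (by linarith) (by linarith)
  have hcos : cos (2 * π / 3 - X - Y) < cos t :=
    cos_lt_cos_of_nonneg_of_le_pi ht (by linarith) (by linarith)
  have hlt' : 1 < (2 * sin X) ^ 2 + (2 * sin Y) ^ 2 -
      2 * (2 * sin X) * (2 * sin Y) * cos (2 * π / 3 - X - Y) := by
    nlinarith [mul_pos hsX hsY]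
  rw [four_sin_sq_add_four_sin_sq_sub] at hlt'
  set w := X + Y - π / 3 with hw
  have e1 : X + Y = w + π / 3 := by rw [hw]; ring
  have e2 : 2 * π / 3 - X - Y = π / 3 - w := by rw [hw]; ring
  have hle : cos w ≤ cos (X - Y) := by
    rw [← cos_abs (X - Y)]
    exact cos_le_cos_of_nonneg_of_le_pi (abs_nonneg _) (by linarith)
      (abs_le.2 ⟨by linarith, by linarith⟩)
  have hc : 0 ≤ cos w := cos_nonneg_of_neg_pi_div_two_le_of_le (by linarith) (by linarith)
  clear_value w
  rw [e1, e2, cos_add w, cos_sub _ w, cos_pi_div_three, sin_pi_div_three] at hlt'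
  have h3 : √3 ^ 2 = 3 := sq_sqrt (by norm_num)
  have key : 4 * cos w * (cos w - cos (X - Y)) > 0 := by
    have := sin_sq_add_cos_sq w
    have e : (cos w * (1 / 2) - sin w * (√3 / 2)) * (1 / 2 * cos w + √3 / 2 * sin w) =
        cos w ^ 2 - 3 / 4 := by
      linear_combination (-(sin w ^ 2) / 4) * h3 - 3 / 4 * this
    linarith
  nlinarith

/-- Upper bound for the angle between sides of length `2 sin X` and `2 sin Y` whose opposite side
has length at most `2 sin L`. -/
lemma angle_add_le {X Y L t : ℝ} (hX : π / 6 ≤ X) (hXL : X ≤ L)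
    (hY : π / 6 ≤ Y) (hYL : Y ≤ L) (hL : L ≤ π / 4) (ht : t ≤ π)
    (h : (2 * sin X) ^ 2 + (2 * sin Y) ^ 2 - 2 * (2 * sin X) * (2 * sin Y) * cos t ≤
      (2 * sin L) ^ 2) :
    t + X + Y ≤ 2 * L + π / 3 := by
  by_contra! hlt
  have hπ := pi_pos
  have hsX : 0 < sin X := sin_pos_of_pos_of_lt_pi (by linarith) (by linarith)
  have hsY : 0 < sin Y := sin_pos_of_pos_of_lt_pi (by linarith) (by linarith)
  have hsL : 0 < sin L := sin_pos_of_pos_of_lt_pi (by linarith) (by linarith)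
  set f := 2 * L + π / 3 - X - Y with hf
  have hcos : cos t < cos f := cos_lt_cos_of_nonneg_of_le_pi (by linarith) ht (by linarith)
  have hlt' : (2 * sin X) ^ 2 + (2 * sin Y) ^ 2 - 2 * (2 * sin X) * (2 * sin Y) * cos f <
      (2 * sin L) ^ 2 := by
    nlinarith [mul_pos hsX hsY]
  rw [four_sin_sq_add_four_sin_sq_sub] at hlt'
  have hcu : 0 ≤ cos (X + Y) :=
    cos_nonneg_of_neg_pi_div_two_le_of_le (by linarith) (by linarith)
  have hcf : 0 ≤ cos f := cos_nonneg_of_neg_pi_div_two_le_of_le (by linarith) (by linarith)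
  have hv := cos_le_one (X - Y)
  have hprod : 4 * (1 - cos (X + Y)) * (1 - cos f) < (2 * sin L) ^ 2 := by nlinarith
  have hu2 : cos (X + Y) = 1 - 2 * sin ((X + Y) / 2) ^ 2 := by
    rw [show X + Y = 2 * ((X + Y) / 2) by ring, cos_two_mul, cos_sq']; ring_nf
  have hf2 : cos f = 1 - 2 * sin (f / 2) ^ 2 := by
    rw [show f = 2 * (f / 2) by ring, cos_two_mul, cos_sq']; ring_nf
  have hlow : sin L ≤ 2 * sin ((X + Y) / 2) * sin (f / 2) := by
    have e1 : 2 * sin ((X + Y) / 2) * sin (f / 2) =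
        cos ((X + Y) / 2 - f / 2) - cos ((X + Y) / 2 + f / 2) := by
      rw [cos_sub, cos_add]; ring
    have e2 : cos (L - π / 6) - cos (L + π / 6) = sin L := by
      rw [cos_sub, cos_add, sin_pi_div_six]; ring
    have e3 : (X + Y) / 2 + f / 2 = L + π / 6 := by rw [hf]; ring
    have hle : cos (L - π / 6) ≤ cos ((X + Y) / 2 - f / 2) := by
      rw [← cos_abs ((X + Y) / 2 - f / 2)]
      exact cos_le_cos_of_nonneg_of_le_pi (abs_nonneg _) (by linarith)
        (abs_le.2 ⟨by linarith, by linarith⟩)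
    rw [e1, e3]; linarith
  rw [hu2, hf2] at hprod
  nlinarith

/-- A predicate on `ZMod n` that holds somewhere and is stable under `j ↦ j + 1` holds
everywhere. -/
lemma ZMod.forall_of_add_one {n : ℕ} [NeZero n] {P : ZMod n → Prop} (j₀ : ZMod n) (h₀ : P j₀)
    (h : ∀ j, P j → P (j + 1)) (j : ZMod n) : P j := by
  have key : ∀ k : ℕ, P (j₀ + k) := by
    intro k
    induction k with
    | zero => simpa using h₀
    | succ k ih => simpa [add_assoc] using h _ ih
  simpa using key (j - j₀).val

/-- A nonconstant cyclic `±1` sequence changes sign at least twice. -/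
lemma ZMod.sum_abs_add_le_of_ne {n : ℕ} [NeZero n] {σ : ZMod n → ℤ}
    (hσ : ∀ j, σ j = 1 ∨ σ j = -1) {a b : ZMod n} (ha : σ a = 1) (hb : σ b = -1) :
    ∑ j, |σ j + σ (j - 1)| ≤ 2 * (n : ℤ) - 4 := by
  obtain ⟨i, hi, hi'⟩ : ∃ i, σ i = 1 ∧ σ (i + 1) = -1 := by
    by_contra! hcon
    have := ZMod.forall_of_add_one (P := fun j => σ j = 1) a ha
      (fun j hj => (hσ (j + 1)).resolve_right (hcon j hj)) b
    omega
  obtain ⟨k, hk, hk'⟩ : ∃ k, σ k = -1 ∧ σ (k + 1) = 1 := by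
    by_contra! hcon
    have := ZMod.forall_of_add_one (P := fun j => σ j = -1) b hb
      (fun j hj => (hσ (j + 1)).resolve_left (hcon j hj)) a
    omega
  have hik : i + 1 ≠ k + 1 := by
    intro h
    rw [h] at hi'
    omega
  have hle : ∀ j, |σ j + σ (j - 1)| ≤
      2 - ((if j = i + 1 then 2 else 0) + (if j = k + 1 then 2 else 0)) := by
    intro j
    by_cases h1 : j = i + 1
    · subst h1
      simp [hi, hi', hik]
    · by_cases h2 : j = k + 1
      · subst h2
        simp [hk, hk', h1]
      · rcases hσ j with h | h <;> rcases hσ (j - 1) with h' | h' <;> simp [h, h', h1, h2]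
  refine (Finset.sum_le_sum fun j _ => hle j).trans ?_
  rw [Finset.sum_sub_distrib, Finset.sum_add_distrib]
  simp [ZMod.card]
  omega

/-- The turning angles of a closed sequence of nonzero complex numbers sum to a multiple
of `2π`. -/
lemma exists_sum_arg_div_eq {n : ℕ} [NeZero n] (p : ZMod n → ℂ) (hp : ∀ j, p j ≠ 0) :
    ∃ m : ℤ, ∑ j, (p j / p (j - 1)).arg = m * (2 * π) := by
  have hprod : ∏ j, p j / p (j - 1) = 1 := by
    rw [Finset.prod_div_distrib, show ∏ j, p (j - 1) = ∏ j, p j from (Equiv.subRight (1 : ZMod n)).prod_comp p,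
      div_self (Finset.prod_ne_zero_iff.2 fun j _ => hp j)]
  have hcoe : ∀ s : Finset (ZMod n), ((∑ j ∈ s, (p j / p (j - 1)).arg : ℝ) : Real.Angle) =
      ((∏ j ∈ s, p j / p (j - 1)).arg : Real.Angle) := by
    intro s
    induction s using Finset.induction_on with
    | empty => simp
    | insert a s ha ih =>
      rw [Finset.sum_insert ha, Finset.prod_insert ha, Real.Angle.coe_add, ih,
        Complex.arg_mul_coe_angle (div_ne_zero (hp _) (hp _))
          (Finset.prod_ne_zero_iff.2 fun j _ => div_ne_zero (hp _) (hp _))]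
  have h := hcoe Finset.univ
  rw [hprod, Complex.arg_one, Real.Angle.angle_eq_iff_two_pi_dvd_sub] at h
  obtain ⟨m, hm⟩ := h
  exact ⟨m, by linarith⟩

/-- Estimate for signed sums of quantities `e j`, each lying within `D / 2` of
`D / 2 - H (j - 1) - H j`, where `0 ≤ H ≤ D / 2`. -/
lemma ZMod.abs_sum_sign_mul_le {n : ℕ} [NeZero n] {σ : ZMod n → ℤ}
    (hσ : ∀ j, σ j = 1 ∨ σ j = -1) {e H : ZMod n → ℝ} {D : ℝ}
    (hH : ∀ j, 0 ≤ H j ∧ H j ≤ D / 2)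
    (he : ∀ j, -(H (j - 1) + H j) ≤ e j ∧ e j ≤ D - (H (j - 1) + H j)) :
    |∑ j, σ j * e j| ≤ n * (D / 2) + D / 4 * ((∑ j, |σ j + σ (j - 1)| : ℤ) : ℝ) := by
  have hsplit : ∑ j, (σ j : ℝ) * e j =
      ∑ j, (σ j : ℝ) * (e j + H (j - 1) + H j - D / 2) +
      ∑ j, ((σ j : ℝ) + σ (j - 1)) * (D / 4 - H (j - 1)) := by
    have hshift : ∑ j, (σ (j - 1) : ℝ) * (D / 4 - H (j - 1)) =
        ∑ j, (σ j : ℝ) * (D / 4 - H j) :=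
      (Equiv.subRight (1 : ZMod n)).sum_comp fun j => (σ j : ℝ) * (D / 4 - H j)
    simp only [add_mul _ _ (D / 4 - H _), Finset.sum_add_distrib]
    rw [hshift, ← Finset.sum_add_distrib, ← Finset.sum_add_distrib]
    exact Finset.sum_congr rfl fun j _ => by ring
  rw [hsplit]
  refine (abs_add_le _ _).trans (add_le_add ?_ ?_)
  · refine (Finset.abs_sum_le_sum_abs _ _).trans ?_
    have : ∀ j ∈ Finset.univ, |(σ j : ℝ) * (e j + H (j - 1) + H j - D / 2)| ≤ D / 2 := by
      intro j _
      have := he j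
      have habs : |(σ j : ℝ)| = 1 := by rcases hσ j with h | h <;> simp [h]
      rw [abs_mul, habs, one_mul]
      exact abs_le.2 ⟨by linarith, by linarith⟩
    refine (Finset.sum_le_card_nsmul _ _ _ this).trans (by simp [ZMod.card])
  · refine (Finset.abs_sum_le_sum_abs _ _).trans ?_
    push_cast
    rw [Finset.mul_sum]
    refine Finset.sum_le_sum fun j _ => ?_
    rw [abs_mul, mul_comm]
    have := hH (j - 1)
    exact mul_le_mul_of_nonneg_right (abs_le.2 ⟨by linarith, by linarith⟩) (abs_nonneg _)

theorem wheel_mod_three_lower_bound (n : ℕ) (hn : 3 ≤ n) (hmod : n % 6 = 3)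
    (l : ℝ) (hl : 1 ≤ l) (p : ZMod n → ℂ)
    (hp : ∀ j : ZMod n,
      1 ≤ ‖p j‖ ∧ ‖p j‖ ≤ l ∧ 1 ≤ ‖p j - p (j - 1)‖ ∧ ‖p j - p (j - 1)‖ ≤ l) :
    2 * Real.sin (Real.pi / 6 * ((n : ℝ) / ((n : ℝ) - 1))) ≤ l := by
  have hπ := pi_pos
  have : NeZero n := ⟨by omega⟩
  have hn' : (3 : ℝ) ≤ n := by exact_mod_cast hn
  by_contra! hlt
  set A := π / 6 * ((n : ℝ) / ((n : ℝ) - 1)) with hA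
  have hA0 : 0 ≤ A := mul_nonneg (by linarith) (div_nonneg (by linarith) (by linarith))
  have hAn : A * (n - 1) = π / 6 * n := by
    have : (n : ℝ) - 1 ≠ 0 := by linarith
    rw [hA]; field_simp
  have hA4 : A ≤ π / 4 := by
    have : (n : ℝ) / (n - 1) ≤ 3 / 2 := by
      rw [div_le_div_iff₀ (by linarith) (by norm_num)]; linarith
    rw [hA]; nlinarith
  set L := arcsin (l / 2) with hL
  have hLA : L < A := by
    rw [hL, arcsin_lt_iff_lt_sin' ⟨by linarith, by linarith⟩]
    linarith
  have hl2 : l ≤ 2 := by linarith [sin_le_one A]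
  set X : ZMod n → ℝ := fun j => arcsin (‖p j‖ / 2) with hX
  have hsix : arcsin (1 / 2) = π / 6 := by
    rw [← sin_pi_div_six, arcsin_sin (by linarith) (by linarith)]
  have hX1 : ∀ j, π / 6 ≤ X j := fun j => by
    rw [← hsix]; exact monotone_arcsin (by linarith [(hp j).1])
  have hX2 : ∀ j, X j ≤ L := fun j => monotone_arcsin (by linarith [(hp j).2.1])
  have hXs : ∀ j, 2 * sin (X j) = ‖p j‖ := fun j => by
    rw [hX, sin_arcsin (by linarith [(hp j).1]) (by linarith [(hp j).2.1])]; ring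
  have hLs : 2 * sin L = l := by
    rw [hL, sin_arcsin (by linarith) (by linarith)]; ring
  have hp0 : ∀ j, p j ≠ 0 := fun j => norm_pos_iff.1 (by linarith [(hp j).1])
  set T : ZMod n → ℝ := fun j => (p j / p (j - 1)).arg with hT
  have hlaw : ∀ j, ‖p j - p (j - 1)‖ ^ 2 = (2 * sin (X j)) ^ 2 + (2 * sin (X (j - 1))) ^ 2 -
      2 * (2 * sin (X j)) * (2 * sin (X (j - 1))) * cos |T j| := fun j => by
    have h := InnerProductGeometry.norm_sub_sq_eq_norm_sq_add_norm_sq_sub_two_mul_norm_mul_norm_mul_cos_angle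
      (p j) (p (j - 1))
    rw [Complex.angle_eq_abs_arg (hp0 _) (hp0 _)] at h
    rw [hXs, hXs]
    linarith
  have hlow : ∀ j, 2 * π / 3 ≤ |T j| + X j + X (j - 1) := fun j => by
    refine two_pi_div_three_le_angle_add (hX1 _) (hX1 _) (abs_nonneg _) ?_
    rw [← hlaw]
    exact one_le_pow₀ (hp j).2.2.1
  have hupp : ∀ j, |T j| + X j + X (j - 1) ≤ 2 * L + π / 3 := fun j => by
    refine angle_add_le (hX1 _) (hX2 _) (hX1 _) (hX2 _) (by linarith) (Complex.abs_arg_le_pi _) ?_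
    rw [← hlaw, hLs]
    exact pow_le_pow_left₀ (norm_nonneg _) (hp j).2.2.2 2
  obtain ⟨m, hm⟩ := exists_sum_arg_div_eq p hp0
  set σ : ZMod n → ℤ := fun j => if 0 ≤ T j then 1 else -1 with hσdef
  have hσ : ∀ j, σ j = 1 ∨ σ j = -1 := fun j => by
    by_cases h : 0 ≤ T j <;> simp [hσdef, h]
  have hσT : ∀ j, (σ j : ℝ) * |T j| = T j := fun j => by
    by_cases h : 0 ≤ T j
    · simp [hσdef, h, abs_of_nonneg h]
    · simp [hσdef, h, abs_of_neg (not_le.1 h)]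
  have hbound := ZMod.abs_sum_sign_mul_le (e := fun j => |T j| - π / 3)
    (H := fun j => X j - π / 6) (D := 2 * L - π / 3) hσ
    (fun j => ⟨by linarith [hX1 j], by linarith [hX2 j]⟩)
    (fun j => ⟨by linarith [hlow j], by linarith [hupp j]⟩)
  have hsum : ∑ j, (σ j : ℝ) * (|T j| - π / 3) =
      π / 3 * ((6 * m - ∑ j, σ j : ℤ) : ℝ) := by
    simp only [mul_sub, hσT, Finset.sum_sub_distrib, ← Finset.sum_mul]
    rw [hm]
    push_cast
    ring
  rw [hsum, abs_mul, abs_of_pos (by linarith), ← Int.cast_abs] at hbound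
  have hD : (2 * L - π / 3) * (n - 1) < π / 3 := by nlinarith
  have hD0 : 0 ≤ 2 * L - π / 3 := by linarith [hX1 0, hX2 0]
  by_cases hconst : (∀ j, σ j = 1) ∨ ∀ j, σ j = -1
  · have hS : 3 ≤ |6 * m - ∑ j, σ j| ∧ ∑ j, |σ j + σ (j - 1)| = 2 * n := by
      rcases hconst with h | h <;> simp [h, ZMod.card]
      all_goals exact ⟨by rw [le_abs]; omega, by omega⟩
    have h3 : (3 : ℝ) ≤ (|6 * m - ∑ j, σ j| : ℤ) := by exact_mod_cast hS.1
    rw [hS.2] at hbound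
    push_cast at hbound h3
    nlinarith
  · push Not at hconst
    obtain ⟨⟨b, hb⟩, a, ha⟩ := hconst
    have hsw := ZMod.sum_abs_add_le_of_ne hσ ((hσ a).resolve_right ha) ((hσ b).resolve_left hb)
    have hodd : (∑ j, σ j) % 2 = 1 := by
      have : ∀ j ∈ Finset.univ, σ j ≡ 1 [ZMOD 2] := fun j _ => by
        rcases hσ j with h | h <;> rw [h] <;> decide
      have := Int.ModEq.sum this
      simp only [Finset.sum_const, Finset.card_univ, ZMod.card, nsmul_eq_mul, mul_one] at this
      have h2 : (∑ j, σ j) % 2 = (n : ℤ) % 2 := this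
      omega
    have h1 : 1 ≤ |6 * m - ∑ j, σ j| := by rw [le_abs]; omega
    have h1' : (1 : ℝ) ≤ (|6 * m - ∑ j, σ j| : ℤ) := by exact_mod_cast h1
    have hsw' : ((∑ j, |σ j + σ (j - 1)| : ℤ) : ℝ) ≤ 2 * n - 4 := by exact_mod_cast hsw
    nlinarith
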